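/- arXiv:0908.3832 — 3 statements merged into one kernel-verified Lean document; each statement's English description precedes it below -/
import Mathlib

section
/- If n is a positive integer with n ∣ u_n, and m is a positive integer all of whose prime factors divide u_n·Δ, then nm ∣ u_{nm}. -/
/-- Lucas sequence of the first kind: `u 0 = 0`, `u 1 = 1`,
`u (n+2) = P * u (n+1) - Q * u n`. -/
def lucasU (P Q : ℤ) : ℕ → ℤ
  | 0 => 0
  | 1 => 1
  | n + 2 => P * lucasU P Q (n + 1) - Q * lucasU P Q n

theorem lucasU_add_two (P Q : ℤ) (n : ℕ) :
    lucasU P Q (n + 2) = P * lucasU P Q (n + 1) - Q * lucasU P Q n := by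
  rw [lucasU]

theorem lucasU_add (P Q : ℤ) (m n : ℕ) :
    lucasU P Q (m + n) = lucasU P Q m * lucasU P Q (n + 1)
        + lucasU P Q n * (lucasU P Q (m + 1) - P * lucasU P Q m) ∧
      lucasU P Q (m + n + 1) = lucasU P Q (m + 1) * lucasU P Q (n + 1)
        - Q * lucasU P Q m * lucasU P Q n := by
  induction n with
  | zero => simp [lucasU]
  | succ n ih =>
    obtain ⟨h₁, h₂⟩ := ih
    refine ⟨?_, ?_⟩
    · rw [← add_assoc, h₂, lucasU_add_two P Q n]
      ring
    · rw [← add_assoc, lucasU_add_two P Q (m + n), h₁, h₂, lucasU_add_two P Q n]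
      ring

theorem lucasU_cassini (P Q : ℤ) (n : ℕ) :
    lucasU P Q (n + 1) ^ 2 - P * lucasU P Q (n + 1) * lucasU P Q n
      + Q * lucasU P Q n ^ 2 = Q ^ n := by
  induction n with
  | zero => simp [lucasU]
  | succ n ih =>
    rw [lucasU_add_two P Q n, pow_succ Q, ← ih]
    ring

/-- Lucas sequence of the second kind, expressed through the first kind. -/
def lucasV (P Q : ℤ) (n : ℕ) : ℤ :=
  2 * lucasU P Q (n + 1) - P * lucasU P Q n

theorem lucasV_sq_sub (P Q : ℤ) (n : ℕ) :
    lucasV P Q n ^ 2 - 4 * Q ^ n = (P ^ 2 - 4 * Q) * lucasU P Q n ^ 2 := by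
  rw [lucasV, ← lucasU_cassini P Q n]
  ring

theorem lucasU_add_add (P Q : ℤ) (m n : ℕ) :
    lucasU P Q (m + n + n) = lucasV P Q n * lucasU P Q (m + n) - Q ^ n * lucasU P Q m := by
  rw [(lucasU_add P Q (m + n) n).1, (lucasU_add P Q m n).2, (lucasU_add P Q m n).1, lucasV,
    ← lucasU_cassini P Q n]
  ring

theorem lucasU_mul (P Q : ℤ) (n k : ℕ) :
    lucasU P Q (n * k) = lucasU P Q n * lucasU (lucasV P Q n) (Q ^ n) k := by
  induction k using Nat.twoStepInduction with
  | zero => simp [lucasU]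
  | one => simp [lucasU]
  | more k h₁ h₂ =>
    rw [show n * (k + 2) = n * k + n + n by ring, lucasU_add_add,
      show n * k + n = n * (k + 1) by ring, h₁, h₂, lucasU_add_two _ _ k]
    ring

theorem discrim_dvd_two_pow_mul_lucasU_sub (P Q : ℤ) (n : ℕ) :
    P ^ 2 - 4 * Q ∣ 2 ^ n * lucasU P Q (n + 1) - (n + 1) * P ^ n := by
  induction n using Nat.twoStepInduction with
  | zero => simp [lucasU]
  | one => simp [lucasU]
  | more n h₁ h₂ =>
    obtain ⟨d, hd⟩ := h₁
    obtain ⟨c, hc⟩ := h₂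
    refine ⟨2 * P * c - 4 * Q * d + (n + 1) * P ^ n, ?_⟩
    rw [lucasU_add_two P Q (n + 1)]
    push_cast at hc ⊢
    linear_combination 2 * P * hc - 4 * Q * hd

theorem prime_dvd_lucasU_of_dvd_discrim {P Q : ℤ} {p : ℕ} (hp : p.Prime)
    (h : (p : ℤ) ∣ P ^ 2 - 4 * Q) : (p : ℤ) ∣ lucasU P Q p := by
  have hpZ : Prime (p : ℤ) := Nat.prime_iff_prime_int.mp hp
  rcases hp.eq_two_or_odd' with rfl | hodd
  · have h4 : ((2 : ℕ) : ℤ) ∣ 4 * Q := ⟨2 * Q, by push_cast; ring⟩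
    have hP : ((2 : ℕ) : ℤ) ∣ P := hpZ.dvd_of_dvd_pow ((dvd_sub_left h4).mp h)
    simpa [lucasU] using hP
  · obtain ⟨k, rfl⟩ := Nat.exists_eq_succ_of_ne_zero hp.ne_zero
    have h₁ := h.trans (discrim_dvd_two_pow_mul_lucasU_sub P Q k)
    have h₂ : ((k.succ : ℕ) : ℤ) ∣ (k + 1) * P ^ k := ⟨P ^ k, by push_cast; ring⟩
    refine (hpZ.dvd_or_dvd ((dvd_sub_left h₂).mp h₁)).resolve_left fun h₃ => ?_
    have h₄ : k.succ ∣ 2 := by exact_mod_cast hpZ.dvd_of_dvd_pow h₃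
    rw [(Nat.prime_dvd_prime_iff_eq hp Nat.prime_two).mp h₄] at hodd
    exact absurd hodd (by decide)

theorem mul_prime_dvd_lucasU {P Q : ℤ} {n p : ℕ} (hp : p.Prime)
    (hn : (n : ℤ) ∣ lucasU P Q n) (h : (p : ℤ) ∣ lucasU P Q n * (P ^ 2 - 4 * Q)) :
    ((n * p : ℕ) : ℤ) ∣ lucasU P Q (n * p) := by
  rw [lucasU_mul, Nat.cast_mul]
  refine mul_dvd_mul hn (prime_dvd_lucasU_of_dvd_discrim hp ?_)
  rw [lucasV_sq_sub]
  exact h.trans ⟨lucasU P Q n, by ring⟩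

/-- If `n ∈ S` and every prime factor of `m` divides `u_n · Δ`,
then `nm ∈ S`. -/
theorem mul_mem_S_of_primeFactors_dvd (P Q : ℤ) (n m : ℕ) (hn : 0 < n) (hm : 0 < m)
    (hnS : (n : ℤ) ∣ lucasU P Q n)
    (hfac : ∀ p : ℕ, p.Prime → p ∣ m → (p : ℤ) ∣ lucasU P Q n * (P ^ 2 - 4 * Q)) :
    ((n * m : ℕ) : ℤ) ∣ lucasU P Q (n * m) := by
  induction m using induction_on_primes with
  | zero => exact absurd hm (lt_irrefl 0)
  | one => simpa using hnS
  | prime_mul p a hp ih =>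
    have hna := ih (Nat.pos_of_mul_pos_left hm) fun q hq hqa => hfac q hq (hqa.mul_left p)
    rw [mul_comm p a, ← mul_assoc]
    refine mul_prime_dvd_lucasU hp hna ((hfac p hp (dvd_mul_right p a)).trans ?_)
    exact mul_dvd_mul_right ⟨_, lucasU_mul P Q n a⟩ _
end

section
/- A prime p divides u_n for some n ≥ 1 if and only if p is regular, i.e., p ∤ Q or p ∣ P. Equivalently, if p divides Q but not P (p is irregular), then p divides no u_n with n ≥ 1, and every regular prime divides some u_n with n ≥ 1. -/
theorem not_dvd_lucasU_succ {P Q : ℤ} {p : ℕ} (hp : p.Prime) (hQ : (p : ℤ) ∣ Q)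
    (hP : ¬ (p : ℤ) ∣ P) (n : ℕ) : ¬ (p : ℤ) ∣ lucasU P Q (n + 1) := by
  have hp' : Prime (p : ℤ) := Nat.prime_iff_prime_int.mp hp
  induction n with
  | zero => simpa [lucasU] using hp'.not_dvd_one
  | succ n ih =>
    rw [lucasU, dvd_sub_left (hQ.mul_right _), hp'.dvd_mul]
    tauto

/-- The map sending a pair of consecutive terms of a Lucas recurrence to the next such pair. -/
def lucasStep {R : Type*} [CommRing R] (P Q : R) (x : R × R) : R × R :=
  (x.2, P * x.2 - Q * x.1)

theorem lucasStep_injective {R : Type*} [CommRing R] [IsDomain R] (P : R) {Q : R} (hQ : Q ≠ 0) :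
    Function.Injective (lucasStep P Q) := by
  rintro ⟨a, b⟩ ⟨c, d⟩ h
  obtain ⟨rfl, h⟩ := Prod.mk.inj h
  exact Prod.ext (mul_left_cancel₀ hQ (sub_right_injective h)) rfl

theorem lucasStep_iterate {R : Type*} [CommRing R] (P Q : ℤ) (n : ℕ) :
    (lucasStep (P : R) (Q : R))^[n] (0, 1) = (↑(lucasU P Q n), ↑(lucasU P Q (n + 1))) := by
  induction n with
  | zero => simp [lucasU]
  | succ n ih =>
    rw [Function.iterate_succ_apply', ih]
    simp [lucasStep, lucasU]

theorem exists_dvd_lucasU_of_not_dvd (P : ℤ) {Q : ℤ} {p : ℕ} (hp : p.Prime)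
    (hQ : ¬ (p : ℤ) ∣ Q) : ∃ n : ℕ, 1 ≤ n ∧ (p : ℤ) ∣ lucasU P Q n := by
  have : Fact p.Prime := ⟨hp⟩
  have hQ' : (Q : ZMod p) ≠ 0 := by rwa [Ne, ZMod.intCast_zmod_eq_zero_iff_dvd]
  obtain ⟨n, hn, h⟩ := (lucasStep_injective (P : ZMod p) hQ').mem_periodicPts (0, 1)
  rw [Function.IsPeriodicPt, Function.IsFixedPt, lucasStep_iterate] at h
  exact ⟨n, hn, (ZMod.intCast_zmod_eq_zero_iff_dvd _ p).mp (congrArg Prod.fst h)⟩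

/-- A prime `p` divides some `u_n` with `n ≥ 1` iff `p` is regular,
i.e. `p ∤ Q` or `p ∣ P`. -/
theorem prime_dvd_some_lucasU_iff_regular (P Q : ℤ) (p : ℕ) (hp : p.Prime) :
    (∃ n : ℕ, 1 ≤ n ∧ (p : ℤ) ∣ lucasU P Q n) ↔ (¬ (p : ℤ) ∣ Q ∨ (p : ℤ) ∣ P) := by
  constructor
  · rintro ⟨n, hn, h⟩
    obtain ⟨m, rfl⟩ := Nat.exists_eq_add_of_le' hn
    by_contra! hreg
    exact not_dvd_lucasU_succ hp hreg.1 hreg.2 m h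
  · rintro (hQ | hP)
    · exact exists_dvd_lucasU_of_not_dvd P hp hQ
    · exact ⟨2, by norm_num, by simpa [lucasU] using hP⟩
end

section
/- If m and n are positive integers with m ∣ u_m and n ∣ u_n, then lcm(m,n) divides u_{lcm(m,n)}. -/
theorem lucasU_add_add_one (P Q : ℤ) (a b : ℕ) :
    lucasU P Q (a + b + 1) =
      lucasU P Q (a + 1) * lucasU P Q (b + 1) - Q * lucasU P Q a * lucasU P Q b := by
  induction b using Nat.twoStepInduction with
  | zero => simp [lucasU]
  | one => simp [lucasU]; ring
  | more b ih₁ ih₂ =>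
    have h : lucasU P Q (a + (b + 2) + 1) =
        P * lucasU P Q (a + (b + 1) + 1) - Q * lucasU P Q (a + b + 1) := rfl
    have h₁ : lucasU P Q (b + 2 + 1) =
        P * lucasU P Q (b + 1 + 1) - Q * lucasU P Q (b + 1) := rfl
    have h₂ : lucasU P Q (b + 2) = P * lucasU P Q (b + 1) - Q * lucasU P Q b := rfl
    rw [h, ih₁, ih₂, h₁, h₂]
    ring

theorem lucasU_dvd_mul (P Q : ℤ) (m k : ℕ) : lucasU P Q m ∣ lucasU P Q (m * k) := by
  induction k with
  | zero => simp [lucasU]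
  | succ k ih =>
    cases m with
    | zero => simp
    | succ m =>
      rw [Nat.mul_succ, ← Nat.add_assoc, lucasU_add_add_one]
      exact dvd_sub (dvd_mul_left _ _) ((ih.mul_left Q).mul_right _)

theorem lucasU_dvd_of_dvd (P Q : ℤ) {m n : ℕ} (h : m ∣ n) : lucasU P Q m ∣ lucasU P Q n := by
  obtain ⟨k, rfl⟩ := h
  exact lucasU_dvd_mul P Q m k

/-- If `m ∈ S` and `n ∈ S` then `lcm(m, n) ∈ S`. -/
theorem lcm_mem_S (P Q : ℤ) (m n : ℕ) (hm : 0 < m) (hn : 0 < n)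
    (hmS : (m : ℤ) ∣ lucasU P Q m) (hnS : (n : ℤ) ∣ lucasU P Q n) :
    ((Nat.lcm m n : ℕ) : ℤ) ∣ lucasU P Q (Nat.lcm m n) := by
  rw [Int.natCast_dvd]
  exact Nat.lcm_dvd
    (Int.natCast_dvd.mp (hmS.trans (lucasU_dvd_of_dvd P Q (Nat.dvd_lcm_left m n))))
    (Int.natCast_dvd.mp (hnS.trans (lucasU_dvd_of_dvd P Q (Nat.dvd_lcm_right m n))))
end
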